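/- A uniformly recurrent infinite word u satisfies property R_3 if and only if C(n) = 2n + 1 for all n ≥ 0 and u has no weak bispecial factor. -/

import Mathlib

variable {A : Type*}

/-- The factor of `u` of length `n` starting at position `j`. -/
def factorAt (u : ℕ → A) (j n : ℕ) : List A :=
  (List.range n).map (fun i => u (j + i))

/-- `j` is an occurrence of the finite word `w` in `u`. -/
def OccursAt (u : ℕ → A) (w : List A) (j : ℕ) : Prop :=
  factorAt u j w.length = w

/-- `w` is a factor of the infinite word `u`. -/
def IsFactor (u : ℕ → A) (w : List A) : Prop :=
  ∃ j, OccursAt u w j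

/-- `v` is a return word of `w` in `u`: the word between two successive occurrences of `w`. -/
def IsReturnWord (u : ℕ → A) (w v : List A) : Prop :=
  ∃ j k, j < k ∧ OccursAt u w j ∧ OccursAt u w k ∧
    (∀ l, j < l → l < k → ¬ OccursAt u w l) ∧ v = factorAt u j (k - j)

/-- The set `R(w)` of return words of `w` in `u`. -/
def returnWords (u : ℕ → A) (w : List A) : Set (List A) :=
  {v | IsReturnWord u w v}

/-- Property `R_m`: every factor of `u` has exactly `m` return words. -/
def PropertyR (u : ℕ → A) (m : ℕ) : Prop :=
  ∀ w, IsFactor u w → (returnWords u w).Finite ∧ (returnWords u w).ncard = m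

/-- The set of left extensions of `w`. -/
def leftExt (u : ℕ → A) (w : List A) : Set A := {a | IsFactor u (a :: w)}

/-- The set of right extensions of `w`. -/
def rightExt (u : ℕ → A) (w : List A) : Set A := {b | IsFactor u (w ++ [b])}

def LeftSpecial (u : ℕ → A) (w : List A) : Prop := 2 ≤ (leftExt u w).ncard

def RightSpecial (u : ℕ → A) (w : List A) : Prop := 2 ≤ (rightExt u w).ncard

/-- The set of pairs `(a, b)` such that `a w b` is a factor of `u`. -/
def extPairs (u : ℕ → A) (w : List A) : Set (A × A) :=
  {p | IsFactor u (p.1 :: (w ++ [p.2]))}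

/-- The bilateral order `B(w)`. -/
noncomputable def bilateralOrder (u : ℕ → A) (w : List A) : ℤ :=
  ((extPairs u w).ncard : ℤ) - (leftExt u w).ncard - (rightExt u w).ncard + 1

/-- `w` is a weak bispecial factor of `u`. -/
def WeakBispecial (u : ℕ → A) (w : List A) : Prop :=
  IsFactor u w ∧ bilateralOrder u w < 0

/-- The factor complexity of `u`. -/
noncomputable def Complexity (u : ℕ → A) (n : ℕ) : ℕ :=
  {w : List A | w.length = n ∧ IsFactor u w}.ncard

/-- `u` is recurrent: every factor occurs at least twice. -/
def Recurrent (u : ℕ → A) : Prop :=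
  ∀ w, IsFactor u w → ∃ j k, j < k ∧ OccursAt u w j ∧ OccursAt u w k

/-- `u` is uniformly recurrent. -/
def UniformlyRecurrent (u : ℕ → A) : Prop :=
  ∀ n : ℕ, ∃ N : ℕ, ∀ w, IsFactor u w → w.length = N →
    ∀ v, IsFactor u v → v.length = n → v <:+: w

def EventuallyPeriodic (u : ℕ → A) : Prop :=
  ∃ p, 0 < p ∧ ∃ N, ∀ n, N ≤ n → u (n + p) = u n

/-- `w` is a maximal right special factor. -/
def MaximalRightSpecial (u : ℕ → A) (w : List A) : Prop :=
  IsFactor u w ∧ RightSpecial u w ∧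
    ∀ v, IsFactor u v → RightSpecial u v → w <:+ v → v = w

/-- The return word `v` of `w` starts with the letter `b`. -/
def StartsWithLetter (w v : List A) (b : A) : Prop := (w ++ [b]) <+: (v ++ w)

section Auxiliary

open Classical

theorem occursAt_iff {u : ℕ → A} {w : List A} {j : ℕ} :
    OccursAt u w j ↔ ∀ i (h : i < w.length), u (j + i) = w[i] := by
  unfold OccursAt factorAt
  constructor
  · intro h i hi
    have := congrArg (fun l => l[i]?) h
    simpa [hi] using this
  · intro h
    apply List.ext_getElem
    · simp
    · intro i h1 h2
      simpa using h i h2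

theorem occursAt_append {u : ℕ → A} {x y : List A} {j : ℕ} :
    OccursAt u (x ++ y) j ↔ OccursAt u x j ∧ OccursAt u y (j + x.length) := by
  simp only [occursAt_iff]
  constructor
  · intro h
    refine ⟨fun i hi => ?_, fun i hi => ?_⟩
    · have := h i (by simp; omega)
      rwa [List.getElem_append_left hi] at this
    · have := h (x.length + i) (by simp; omega)
      rw [List.getElem_append_right (by omega)] at this
      simpa [add_assoc] using this
  · rintro ⟨h1, h2⟩ i hi
    rw [List.length_append] at hi
    rw [List.getElem_append]
    split_ifs with h
    · exact h1 i h
    · rw [← h2 (i - x.length) (by omega)]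
      congr 1
      omega

@[simp] theorem length_factorAt (u : ℕ → A) (j n : ℕ) : (factorAt u j n).length = n := by
  simp [factorAt]

theorem occursAt_factorAt (u : ℕ → A) (j n : ℕ) : OccursAt u (factorAt u j n) j := by
  simp [OccursAt]

theorem isFactor_of_infix {u : ℕ → A} {x y : List A} (h : x <:+: y) (hy : IsFactor u y) :
    IsFactor u x := by
  obtain ⟨p, q, rfl⟩ := h
  obtain ⟨j, hj⟩ := hy
  exact ⟨_, (occursAt_append.1 (occursAt_append.1 hj).1).2⟩

theorem nonempty_rightExt {u : ℕ → A} {x : List A} (hx : IsFactor u x) :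
    (rightExt u x).Nonempty := by
  obtain ⟨j, hj⟩ := hx
  refine ⟨u (j + x.length), j, occursAt_append.2 ⟨hj, ?_⟩⟩
  simp [occursAt_iff]

/-- `w` occurs in `y` exactly once, as a prefix. -/
def PrefixOnce (w y : List A) : Prop :=
  w <+: y ∧ ∀ p q, y = p ++ w ++ q → p = []

/-- `w` occurs in `y` exactly twice, as a proper prefix and as a proper suffix. -/
def CompleteReturn (w y : List A) : Prop :=
  w <+: y ∧ (∃ p, p ≠ [] ∧ y = p ++ w) ∧ ∀ p q, y = p ++ w ++ q → p = [] ∨ q = []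

theorem prefixOnce_self (w : List A) : PrefixOnce w w := by
  refine ⟨List.prefix_rfl, fun p q h => ?_⟩
  have := congrArg List.length h
  simp at this
  exact List.length_eq_zero_iff.1 (by omega)

theorem infix_tail_or_prefixOnce {w y : List A} (h : w <:+: y) :
    PrefixOnce w y ∨ ∃ a z, y = a :: z ∧ w <:+: z := by
  by_cases hz : ∃ a z, y = a :: z ∧ w <:+: z
  · exact Or.inr hz
  · refine Or.inl ?_
    have key : ∀ p q, y = p ++ w ++ q → p = [] := by
      rintro (_ | ⟨a, p⟩) q hq
      · rfl
      · exact absurd ⟨a, p ++ w ++ q, by simpa using hq, p, q, rfl⟩ hz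
    obtain ⟨p, q, hpq⟩ := h
    obtain rfl := key p q hpq.symm
    exact ⟨⟨q, by simpa using hpq⟩, key⟩

theorem exists_suffix_prefixOnce {w y : List A} (h : w <:+: y) :
    ∃ z, z <:+ y ∧ PrefixOnce w z := by
  induction y with
  | nil =>
    obtain rfl := List.infix_nil.1 h
    exact ⟨[], List.suffix_rfl, prefixOnce_self _⟩
  | cons a y ih =>
    rcases infix_tail_or_prefixOnce h with h | ⟨b, z, hz, hw⟩
    · exact ⟨_, List.suffix_rfl, h⟩
    · obtain ⟨rfl, rfl⟩ := List.cons.inj hz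
      obtain ⟨t, ht, ht'⟩ := ih hw
      exact ⟨t, ht.trans (List.suffix_cons _ _), ht'⟩

theorem prefixOnce_or_completeReturn_append_singleton_iff {w x : List A} {b : A}
    (hx : w.length ≤ x.length) :
    PrefixOnce w (x ++ [b]) ∨ CompleteReturn w (x ++ [b]) ↔ PrefixOnce w x := by
  constructor
  · intro h
    refine ⟨?_, fun p q hq => ?_⟩
    · have : w <+: x ++ [b] := h.elim (·.1) (·.1)
      exact List.prefix_of_prefix_length_le this (List.prefix_append _ _) hx
    · rcases h with h | h
      · exact h.2 p (q ++ [b]) (by simp [hq])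
      · exact (h.2.2 p (q ++ [b]) (by simp [hq])).resolve_right (by simp)
  · rintro ⟨h1, h2⟩
    have hpre : w <+: x ++ [b] := h1.trans (List.prefix_append _ _)
    have key : ∀ p q, x ++ [b] = p ++ w ++ q → p = [] ∨ q = [] := by
      intro p q hq
      rcases List.eq_nil_or_concat q with rfl | ⟨q, c, rfl⟩
      · exact Or.inr rfl
      · rw [List.concat_eq_append, ← List.append_assoc] at hq
        exact Or.inl (h2 p q (List.append_inj' hq rfl).1)
    by_cases hs : ∃ p, p ≠ [] ∧ x ++ [b] = p ++ w
    · exact Or.inr ⟨hpre, hs, key⟩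
    · refine Or.inl ⟨hpre, fun p q hq => ?_⟩
      by_contra hp
      obtain rfl := (key p q hq).resolve_left hp
      exact hs ⟨p, hp, by simpa using hq⟩

theorem CompleteReturn.not_prefixOnce {w y : List A} (h : CompleteReturn w y) :
    ¬ PrefixOnce w y := by
  rintro ⟨-, h2⟩
  obtain ⟨-, ⟨p, hp, rfl⟩, -⟩ := h
  exact hp (h2 p [] (by simp))

theorem mem_returnWords_iff {u : ℕ → A} {w v : List A} :
    v ∈ returnWords u w ↔ IsFactor u (v ++ w) ∧ CompleteReturn w (v ++ w) := by
  constructor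
  · rintro ⟨j, k, hjk, hj, hk, hl, rfl⟩
    have hocc : OccursAt u (factorAt u j (k - j) ++ w) j := by
      refine occursAt_append.2 ⟨occursAt_factorAt _ _ _, ?_⟩
      rwa [length_factorAt, Nat.add_sub_cancel' hjk.le]
    refine ⟨⟨j, hocc⟩, ?_, ⟨_, ?_, rfl⟩, fun p q hpq => ?_⟩
    · rw [List.prefix_iff_eq_take]
      apply List.ext_getElem
      · simp
      · intro i h1 h2
        rw [List.getElem_take, ← occursAt_iff.1 hocc, ← occursAt_iff.1 hj]
    · rw [← List.length_pos_iff, length_factorAt]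
      omega
    · by_contra! hne
      have hlen := congrArg List.length hpq
      have h1 := List.length_pos_iff.2 hne.1
      have h2 := List.length_pos_iff.2 hne.2
      simp only [List.length_append, length_factorAt] at hlen
      rw [hpq] at hocc
      exact hl (j + p.length) (by omega) (by omega)
        (occursAt_append.1 (occursAt_append.1 hocc).1).2
  · rintro ⟨⟨j, hj⟩, hpre, ⟨p, hp, hpw⟩, hocc⟩
    obtain rfl := List.append_cancel_right hpw
    have hv := List.length_pos_iff.2 hp
    obtain ⟨h1, h2⟩ := occursAt_append.1 hj
    refine ⟨j, j + v.length, by omega, ?_, h2, fun l hl1 hl2 hl => ?_, ?_⟩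
    · obtain ⟨t, ht⟩ := hpre
      rw [← ht] at hj
      exact (occursAt_append.1 hj).1
    · have hsplit : v ++ w = (v ++ w).take (l - j) ++ w ++ (v ++ w).drop (l - j + w.length) := by
        conv_lhs => rw [← List.take_append_drop (l - j) (v ++ w)]
        rw [List.append_assoc]
        congr 1
        conv_lhs => rw [← List.take_append_drop w.length ((v ++ w).drop (l - j))]
        rw [List.drop_drop]
        congr 1
        apply List.ext_getElem
        · simp
          omega
        · intro i hi1 hi2
          rw [List.getElem_take, List.getElem_drop, ← occursAt_iff.1 hj, ← occursAt_iff.1 hl]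
          congr 1
          omega
      rcases hocc _ _ hsplit with h | h
      · have := congrArg List.length h
        simp only [List.length_take, List.length_append, List.length_nil] at this
        omega
      · have := congrArg List.length h
        simp only [List.length_drop, List.length_append, List.length_nil] at this
        omega
    · rw [Nat.add_sub_cancel_left]
      exact h1.symm

theorem UniformlyRecurrent.exists_infix {u : ℕ → A} (hur : UniformlyRecurrent u) {w : List A}
    (hw : IsFactor u w) : ∃ N, ∀ y, IsFactor u y → N ≤ y.length → w <:+: y := by
  obtain ⟨N, hN⟩ := hur w.length
  refine ⟨N, fun y hy hl => ?_⟩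
  have h := (List.take_prefix N y).isInfix
  exact (hN _ (isFactor_of_infix h hy) (by simp [hl]) w hw rfl).trans h

theorem exists_cons_suffix {u : ℕ → A} {w y : List A} (hy : IsFactor u y) (hwy : w <:+ y)
    (hlt : w.length < y.length) :
    ∃ a, a ∈ leftExt u w ∧ a :: w <:+ y := by
  obtain ⟨p, rfl⟩ := hwy
  rcases List.eq_nil_or_concat p with rfl | ⟨p, a, rfl⟩
  · simp at hlt
  · have h : a :: w <:+ p.concat a ++ w := ⟨p, by simp⟩
    exact ⟨a, isFactor_of_infix h.isInfix hy, h⟩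

theorem PrefixOnce.eq_of_suffix {v y : List A} (h : PrefixOnce v y) (hs : v <:+ y) : y = v := by
  obtain ⟨p, rfl⟩ := hs
  rw [h.2 p [] (by simp), List.nil_append]

theorem UniformlyRecurrent.nonempty_leftExt {u : ℕ → A} (hur : UniformlyRecurrent u)
    {w : List A} (hw : IsFactor u w) : (leftExt u w).Nonempty := by
  obtain ⟨N, hN⟩ := hur.exists_infix hw
  obtain ⟨p, q, hpq⟩ := hN _ ⟨1, occursAt_factorAt u 1 N⟩ (by simp)
  have h := occursAt_factorAt u 1 N
  rw [← hpq] at h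
  have h := (occursAt_append.1 (occursAt_append.1 h).1).2
  refine ⟨u p.length, p.length, ?_⟩
  rw [← List.singleton_append, occursAt_append]
  refine ⟨by simp [occursAt_iff], ?_⟩
  rwa [List.length_singleton, add_comm]

/-- The right multiplicity `#E_r(x) - 1`. -/
noncomputable def rightMult (u : ℕ → A) (x : List A) : ℤ := (rightExt u x).ncard - 1

section Finite

variable [Fintype A] {u : ℕ → A}

theorem rightMult_nonneg {x : List A} (hx : IsFactor u x) : 0 ≤ rightMult u x := by
  have := (Set.ncard_pos (Set.toFinite _)).2 (nonempty_rightExt hx)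
  unfold rightMult
  omega

theorem rightMult_le_of_suffix {x y : List A} (h : x <:+ y) : rightMult u y ≤ rightMult u x := by
  have : (rightExt u y).ncard ≤ (rightExt u x).ncard := by
    refine Set.ncard_le_ncard (fun b hb => ?_) (Set.toFinite _)
    obtain ⟨p, rfl⟩ := h
    exact isFactor_of_infix ⟨p, [], by simp⟩ hb
  unfold rightMult
  omega

/-- The finite set of factors of `u` of length `n`. -/
noncomputable def factors (u : ℕ → A) (n : ℕ) : Finset (List A) :=
  ((List.finite_length_eq A n).subset
    (t := {w : List A | w.length = n ∧ IsFactor u w}) fun _ h => h.1).toFinset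

theorem mem_factors {n : ℕ} {x : List A} : x ∈ factors u n ↔ x.length = n ∧ IsFactor u x := by
  simp [factors]

theorem card_factors (n : ℕ) : (factors u n).card = Complexity u n :=
  (Set.ncard_eq_toFinset_card _ _).symm

theorem sum_factors_append_singleton (n : ℕ) (P : List A → Prop) [DecidablePred P] :
    (((factors u (n + 1)).filter fun y => P y.dropLast).card : ℤ) =
      ∑ x ∈ (factors u n).filter P, ((rightExt u x).ncard : ℤ) := by
  have hc : ∀ x, ((rightExt u x).ncard : ℤ) = ∑ _b ∈ (rightExt u x).toFinset, (1 : ℤ) := by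
    intro x
    rw [Set.ncard_eq_toFinset_card']
    simp
  simp only [hc]
  rw [Finset.sum_sigma', Finset.card_eq_sum_ones]
  push_cast
  symm
  refine Finset.sum_bij (fun p _ => p.1 ++ [p.2]) ?_ ?_ ?_ ?_
  · rintro ⟨x, b⟩ h
    simp only [Finset.mem_sigma, Finset.mem_filter, mem_factors, Set.mem_toFinset] at h
    simp only [Finset.mem_filter, mem_factors]
    refine ⟨⟨by simp [h.1.1.1], h.2⟩, by simpa using h.1.2⟩
  · rintro ⟨x, b⟩ _ ⟨y, c⟩ _ h
    obtain ⟨rfl, h⟩ := List.append_inj' h rfl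
    obtain rfl : b = c := by simpa using h
    rfl
  · intro y hy
    simp only [Finset.mem_filter, mem_factors] at hy
    rcases List.eq_nil_or_concat y with rfl | ⟨x, b, rfl⟩
    · simp at hy
    · rw [List.concat_eq_append] at *
      refine ⟨⟨x, b⟩, ?_, rfl⟩
      simp only [Finset.mem_sigma, Finset.mem_filter, mem_factors, Set.mem_toFinset]
      refine ⟨⟨⟨by simpa using hy.1.1, isFactor_of_infix ⟨[], [b], by simp⟩ hy.1.2⟩,
        by simpa using hy.2⟩, hy.1.2⟩
  · intros
    rfl

theorem sum_factors_cons (n : ℕ) (P : List A → Prop) [DecidablePred P]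
    (f : List A → ℤ) :
    ∑ y ∈ (factors u (n + 1)).filter (fun y => P y.tail), f y =
      ∑ x ∈ (factors u n).filter P, ∑ a ∈ (leftExt u x).toFinset, f (a :: x) := by
  rw [Finset.sum_sigma']
  symm
  refine Finset.sum_bij (fun p _ => p.2 :: p.1) ?_ ?_ ?_ ?_
  · rintro ⟨x, b⟩ h
    simp only [Finset.mem_sigma, Finset.mem_filter, mem_factors, Set.mem_toFinset] at h
    simp only [Finset.mem_filter, mem_factors]
    exact ⟨⟨by simp [h.1.1.1], h.2⟩, by simpa using h.1.2⟩
  · rintro ⟨x, b⟩ _ ⟨y, c⟩ _ h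
    obtain ⟨rfl, rfl⟩ := List.cons.inj h
    rfl
  · rintro (_ | ⟨b, x⟩) hy
    · simp [mem_factors] at hy
    · simp only [Finset.mem_filter, mem_factors] at hy
      refine ⟨⟨x, b⟩, ?_, rfl⟩
      simp only [Finset.mem_sigma, Finset.mem_filter, mem_factors, Set.mem_toFinset]
      exact ⟨⟨⟨by simpa using hy.1.1, isFactor_of_infix ⟨[b], [], by simp⟩ hy.1.2⟩,
        by simpa using hy.2⟩, hy.1.2⟩
  · intros
    rfl

theorem sum_rightMult_leftExt (x : List A) :
    ∑ a ∈ (leftExt u x).toFinset, rightMult u (a :: x) = bilateralOrder u x + rightMult u x := by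
  have h : (extPairs u x).ncard =
      ∑ a ∈ (leftExt u x).toFinset, (rightExt u (a :: x)).ncard := by
    have hs : (extPairs u x).toFinset =
        ((leftExt u x).toFinset.sigma fun a => (rightExt u (a :: x)).toFinset).image
          fun p => (p.1, p.2) := by
      ext ⟨a, b⟩
      simp only [Set.mem_toFinset, Finset.mem_image, Finset.mem_sigma, Sigma.exists,
        Prod.mk.injEq]
      constructor
      · exact fun h => ⟨a, b, ⟨isFactor_of_infix ⟨[], [b], by simp⟩ h, h⟩, rfl, rfl⟩
      · rintro ⟨_, _, ⟨-, h⟩, rfl, rfl⟩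
        exact h
    rw [Set.ncard_eq_toFinset_card', hs, Finset.card_image_of_injective, Finset.card_sigma]
    · simp only [Set.ncard_eq_toFinset_card']
    · rintro ⟨a, b⟩ ⟨c, d⟩ h
      obtain ⟨rfl, rfl⟩ := Prod.mk.inj h
      rfl
  unfold rightMult bilateralOrder
  rw [h, Finset.sum_sub_distrib, Set.ncard_eq_toFinset_card' (leftExt u x)]
  push_cast
  simp only [Finset.sum_const, nsmul_eq_mul, mul_one]
  ring

theorem sum_rightMult_factors (n : ℕ) :
    ∑ x ∈ factors u n, rightMult u x = Complexity u (n + 1) - Complexity u n := by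
  have h := sum_factors_append_singleton (u := u) n fun _ => True
  simp only [Finset.filter_true] at h
  unfold rightMult
  rw [Finset.sum_sub_distrib, ← h, card_factors]
  simp [card_factors]

theorem sum_bilateralOrder_factors (n : ℕ) :
    ∑ x ∈ factors u n, bilateralOrder u x =
      ∑ x ∈ factors u (n + 1), rightMult u x - ∑ x ∈ factors u n, rightMult u x := by
  have h := sum_factors_cons (u := u) n (fun _ => True) (rightMult u)
  simp only [Finset.filter_true, sum_rightMult_leftExt, Finset.sum_add_distrib] at h
  rw [h]
  ring

/-- The factors of length `|w| + n` in which `w` occurs only as a prefix. -/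
noncomputable def onceFactors (u : ℕ → A) (w : List A) (n : ℕ) : Finset (List A) :=
  (factors u (w.length + n)).filter (PrefixOnce w)

/-- The factors of length `|w| + n` that are complete return words of `w`. -/
noncomputable def returnFactors (u : ℕ → A) (w : List A) (n : ℕ) : Finset (List A) :=
  (factors u (w.length + n)).filter (CompleteReturn w)

/-- The factors of length `|w| + n` that contain `w`. -/
noncomputable def factorsContaining (u : ℕ → A) (w : List A) (n : ℕ) : Finset (List A) :=
  (factors u (w.length + n)).filter (w <:+: ·)

theorem factorsContaining_subset (w : List A) (n : ℕ) :
    factorsContaining u w n ⊆ factors u (w.length + n) :=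
  Finset.filter_subset _ _

theorem card_onceFactors_succ (w : List A) (n : ℕ) :
    ((onceFactors u w (n + 1)).card : ℤ) + (returnFactors u w (n + 1)).card =
      (onceFactors u w n).card + ∑ x ∈ onceFactors u w n, rightMult u x := by
  have hd : Disjoint (onceFactors u w (n + 1)) (returnFactors u w (n + 1)) := by
    rw [Finset.disjoint_left]
    intro y h1 h2
    exact (Finset.mem_filter.1 h2).2.not_prefixOnce (Finset.mem_filter.1 h1).2
  have hu : onceFactors u w (n + 1) ∪ returnFactors u w (n + 1) =
      (factors u (w.length + n + 1)).filter fun y => PrefixOnce w y.dropLast := by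
    unfold onceFactors returnFactors
    rw [← Finset.filter_or]
    refine Finset.filter_congr fun y hy => ?_
    have hy := (mem_factors.1 hy).1
    rcases List.eq_nil_or_concat y with rfl | ⟨x, b, rfl⟩
    · simp at hy
    · rw [List.concat_eq_append] at *
      rw [prefixOnce_or_completeReturn_append_singleton_iff, List.dropLast_concat]
      simp at hy
      omega
  have h := sum_factors_append_singleton (u := u) (w.length + n) (PrefixOnce w)
  rw [← hu, Finset.card_union_of_disjoint hd] at h
  unfold rightMult
  rw [Finset.sum_sub_distrib]
  push_cast at h
  rw [h]
  simp [onceFactors]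

theorem onceFactors_zero {w : List A} (hw : IsFactor u w) : onceFactors u w 0 = {w} := by
  ext y
  simp only [onceFactors, Finset.mem_filter, mem_factors, Finset.mem_singleton]
  constructor
  · rintro ⟨⟨h1, -⟩, h2, -⟩
    exact (h2.eq_of_length (by omega)).symm
  · rintro rfl
    exact ⟨⟨rfl, hw⟩, prefixOnce_self _⟩

theorem sum_card_returnFactors {w : List A} (hw : IsFactor u w) (n : ℕ) :
    ((onceFactors u w n).card : ℤ) + ∑ k ∈ Finset.range n, ((returnFactors u w (k + 1)).card : ℤ) =
      1 + ∑ k ∈ Finset.range n, ∑ x ∈ onceFactors u w k, rightMult u x := by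
  induction n with
  | zero => simp [onceFactors_zero hw]
  | succ n ih =>
    rw [Finset.sum_range_succ, Finset.sum_range_succ]
    have := card_onceFactors_succ (u := u) w n
    linarith

theorem factorsContaining_zero {w : List A} (hw : IsFactor u w) :
    factorsContaining u w 0 = {w} := by
  ext y
  simp only [factorsContaining, Finset.mem_filter, mem_factors, Finset.mem_singleton]
  constructor
  · rintro ⟨⟨h1, -⟩, h2⟩
    exact (h2.eq_of_length (by omega)).symm
  · rintro rfl
    exact ⟨⟨rfl, hw⟩, List.infix_rfl⟩

theorem sum_rightMult_factorsContaining_succ (w : List A) (n : ℕ) :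
    ∑ x ∈ factorsContaining u w (n + 1), rightMult u x =
      ∑ x ∈ factorsContaining u w n, rightMult u x +
      ∑ x ∈ factorsContaining u w n, bilateralOrder u x +
      ∑ x ∈ onceFactors u w (n + 1), rightMult u x := by
  have hd : Disjoint ((factors u (w.length + n + 1)).filter fun y => w <:+: y.tail)
      (onceFactors u w (n + 1)) := by
    rw [Finset.disjoint_left]
    intro y h1 h2
    obtain ⟨hy, p, q, hpq⟩ := Finset.mem_filter.1 h1
    have h2 := (Finset.mem_filter.1 h2).2.2
    rcases y with _ | ⟨a, z⟩
    · simp [mem_factors] at hy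
    · have := h2 (a :: p) q (by simp only [List.tail_cons] at hpq; simp [← hpq])
      simp at this
  have hu : factorsContaining u w (n + 1) =
      ((factors u (w.length + n + 1)).filter fun y => w <:+: y.tail) ∪
      onceFactors u w (n + 1) := by
    unfold factorsContaining onceFactors
    rw [← add_assoc, ← Finset.filter_or]
    refine Finset.filter_congr fun y _ => ⟨fun h => ?_, fun h => ?_⟩
    · rcases infix_tail_or_prefixOnce h with hy | ⟨a, z, rfl, hz⟩
      · exact Or.inr hy
      · exact Or.inl hz
    · rcases h with h | h
      · exact h.trans (List.tail_suffix y).isInfix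
      · exact h.1.isInfix
  rw [hu, Finset.sum_union hd, sum_factors_cons _ (w <:+: ·)]
  simp only [sum_rightMult_leftExt, Finset.sum_add_distrib]
  unfold factorsContaining
  ring

theorem sum_rightMult_factorsContaining {w : List A} (hw : IsFactor u w) (n : ℕ) :
    ∑ x ∈ factorsContaining u w n, rightMult u x =
      ∑ k ∈ Finset.range (n + 1), ∑ x ∈ onceFactors u w k, rightMult u x +
      ∑ k ∈ Finset.range n, ∑ x ∈ factorsContaining u w k, bilateralOrder u x := by
  induction n with
  | zero => simp [onceFactors_zero hw, factorsContaining_zero hw]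
  | succ n ih =>
    rw [sum_rightMult_factorsContaining_succ, ih, Finset.sum_range_succ _ (n + 1),
      Finset.sum_range_succ (fun k => ∑ x ∈ factorsContaining u w k, bilateralOrder u x) n]
    ring

/-- For all large `n`, the trees of factors extending `w` up to its next occurrence have
depth at most `n`, and every factor of length at least `n` contains `w`. -/
theorem UniformlyRecurrent.exists_bound (hur : UniformlyRecurrent u) {w : List A}
    (hw : IsFactor u w) : ∃ N, ∀ n, N ≤ n → onceFactors u w n = ∅ ∧
      returnFactors u w (n + 1) = ∅ ∧ factorsContaining u w n = factors u (w.length + n) := by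
  obtain ⟨N, hN⟩ := hur.exists_infix hw
  have hone : ∀ n, N + 1 ≤ n → onceFactors u w n = ∅ := by
    intro n hn
    rw [Finset.eq_empty_iff_forall_notMem]
    intro y hy
    obtain ⟨hy, h⟩ := Finset.mem_filter.1 hy
    obtain ⟨hl, hy⟩ := mem_factors.1 hy
    rcases y with _ | ⟨a, z⟩
    · simp at hl
      omega
    · obtain ⟨p, q, hpq⟩ := hN z (isFactor_of_infix ⟨[a], [], by simp⟩ hy)
        (by simp at hl; omega)
      have := h.2 (a :: p) q (by simp [← hpq])
      simp at this
  refine ⟨N + 1, fun n hn => ⟨hone n hn, ?_, ?_⟩⟩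
  · have := card_onceFactors_succ (u := u) w n
    rw [hone n hn, hone (n + 1) (by omega)] at this
    simpa using this
  · refine Finset.filter_true_of_mem fun y hy => ?_
    obtain ⟨hl, hy⟩ := mem_factors.1 hy
    exact hN y hy (by omega)

theorem image_returnWords {w : List A} {N : ℕ}
    (hN : ∀ n, N ≤ n → returnFactors u w (n + 1) = ∅) :
    (· ++ w) '' returnWords u w =
      ((Finset.range N).biUnion fun n => returnFactors u w (n + 1) : Finset (List A)) := by
  ext y
  simp only [Set.mem_image, mem_returnWords_iff, Finset.coe_biUnion, Set.mem_iUnion,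
    Finset.mem_coe, Finset.mem_range]
  constructor
  · rintro ⟨v, ⟨h1, h2⟩, rfl⟩
    obtain ⟨p, hp, hpw⟩ := h2.2.1
    obtain rfl := List.append_cancel_right hpw
    have hv := List.length_pos_iff.2 hp
    have hm : v ++ w ∈ returnFactors u w (v.length - 1 + 1) := by
      refine Finset.mem_filter.2 ⟨mem_factors.2 ⟨?_, h1⟩, h2⟩
      simp
      omega
    refine ⟨v.length - 1, ?_, hm⟩
    by_contra! hlt
    rw [hN _ hlt] at hm
    simp at hm
  · rintro ⟨n, -, hy⟩
    obtain ⟨hy, h⟩ := Finset.mem_filter.1 hy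
    obtain ⟨p, -, rfl⟩ := h.2.1
    exact ⟨p, ⟨(mem_factors.1 hy).2, h⟩, rfl⟩

theorem finite_returnWords (hur : UniformlyRecurrent u) {w : List A} (hw : IsFactor u w) :
    (returnWords u w).Finite := by
  obtain ⟨N, hN⟩ := hur.exists_bound hw
  refine Set.Finite.of_finite_image (f := (· ++ w)) ?_ (List.append_left_injective w).injOn
  rw [image_returnWords fun n hn => (hN n hn).2.1]
  exact Finset.finite_toSet _

/-- The number of return words of `w` is the number of leaves of the tree of its extensions. -/
theorem exists_ncard_returnWords (hur : UniformlyRecurrent u) {w : List A} (hw : IsFactor u w) :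
    ∃ N, ∀ n, N ≤ n →
      (∀ k, n ≤ k → onceFactors u w k = ∅) ∧
      factorsContaining u w n = factors u (w.length + n) ∧
      ((returnWords u w).ncard : ℤ) =
        1 + ∑ k ∈ Finset.range n, ∑ x ∈ onceFactors u w k, rightMult u x := by
  obtain ⟨N, hN⟩ := hur.exists_bound hw
  refine ⟨N, fun n hn => ⟨fun k hk => (hN k (hn.trans hk)).1, (hN n hn).2.2, ?_⟩⟩
  rw [← sum_card_returnFactors hw, (hN n hn).1,
    ← Set.ncard_image_of_injective _ (List.append_left_injective w),
    image_returnWords fun k hk => (hN k (hn.trans hk)).2.1, Set.ncard_coe_finset,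
    Finset.card_biUnion]
  · simp
  · intro i _ j _ hij
    rw [Function.onFun, Finset.disjoint_left]
    intro y h1 h2
    have h1 := (mem_factors.1 (Finset.mem_filter.1 h1).1).1
    have h2 := (mem_factors.1 (Finset.mem_filter.1 h2).1).1
    omega

theorem exists_sum_rightMult_factors (hur : UniformlyRecurrent u) {w : List A}
    (hw : IsFactor u w) : ∃ n,
      ∑ x ∈ factors u (w.length + n), rightMult u x = (returnWords u w).ncard - 1 +
        ∑ k ∈ Finset.range n, ∑ x ∈ factorsContaining u w k, bilateralOrder u x := by
  obtain ⟨n, hn⟩ := exists_ncard_returnWords hur hw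
  refine ⟨n, ?_⟩
  rw [← (hn n le_rfl).2.1, (hn (n + 1) (by omega)).2.2, sum_rightMult_factorsContaining hw]
  ring

theorem exists_prefixOnce_finset (hur : UniformlyRecurrent u) {w : List A} (hw : IsFactor u w) :
    ∃ T : Finset (List A), (∀ y, y ∈ T ↔ IsFactor u y ∧ PrefixOnce w y) ∧
      ∑ y ∈ T, rightMult u y = (returnWords u w).ncard - 1 := by
  obtain ⟨n, hn⟩ := exists_ncard_returnWords hur hw
  obtain ⟨hempty, -, hcard⟩ := hn n le_rfl
  refine ⟨(Finset.range n).biUnion (onceFactors u w), fun y => ?_, ?_⟩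
  · rw [Finset.mem_biUnion]
    constructor
    · rintro ⟨k, -, hk⟩
      obtain ⟨h1, h2⟩ := Finset.mem_filter.1 hk
      exact ⟨(mem_factors.1 h1).2, h2⟩
    · rintro ⟨h1, h2⟩
      have hlen := h2.1.length_le
      have hm : y ∈ onceFactors u w (y.length - w.length) :=
        Finset.mem_filter.2 ⟨mem_factors.2 ⟨by omega, h1⟩, h2⟩
      refine ⟨_, Finset.mem_range.2 ?_, hm⟩
      by_contra! hlt
      rw [hempty _ hlt] at hm
      simp at hm
  · rw [Finset.sum_biUnion, hcard]
    · ring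
    · intro i _ j _ hij
      rw [Function.onFun, Finset.disjoint_left]
      intro y h1 h2
      have h1 := (mem_factors.1 (Finset.mem_filter.1 h1).1).1
      have h2 := (mem_factors.1 (Finset.mem_filter.1 h2).1).1
      omega

/-- If `v` is the only right special factor in the tree of extensions of `v`, then
`v` has `#E_r(v)` return words. -/
theorem ncard_returnWords_eq (hur : UniformlyRecurrent u) {v : List A} (hv : IsFactor u v)
    (h : ∀ y, IsFactor u y → PrefixOnce v y → 0 < rightMult u y → y = v) :
    ((returnWords u v).ncard : ℤ) = 1 + rightMult u v := by
  obtain ⟨T, hT, hsum⟩ := exists_prefixOnce_finset hur hv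
  rw [Finset.sum_eq_single v] at hsum
  · rw [hsum]
    ring
  · intro y hy hne
    obtain ⟨h1, h2⟩ := (hT y).1 hy
    by_contra h3
    exact hne (h y h1 h2 (lt_of_le_of_ne (rightMult_nonneg h1) (Ne.symm h3)))
  · exact fun hn => absurd ((hT v).2 ⟨hv, prefixOnce_self v⟩) hn

theorem exists_suffix_rightMult_pos {w y : List A} (hy : IsFactor u y) (hwy : w <:+: y)
    (hpos : 0 < rightMult u y) :
    ∃ z, z <:+ y ∧ IsFactor u z ∧ PrefixOnce w z ∧ 0 < rightMult u z := by
  obtain ⟨z, hz, hwz⟩ := exists_suffix_prefixOnce hwy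
  exact ⟨z, hz, isFactor_of_infix hz.isInfix hy, hwz, hpos.trans_le (rightMult_le_of_suffix hz)⟩

theorem PropertyR.not_weakBispecial (hur : UniformlyRecurrent u) (hR : PropertyR u 3)
    (w : List A) : ¬ WeakBispecial u w := by
  rintro ⟨hw, hB⟩
  have hleft := sum_rightMult_leftExt (u := u) w
  have hnn : ∀ a ∈ (leftExt u w).toFinset, 0 ≤ rightMult u (a :: w) := by
    intro a ha
    rw [Set.mem_toFinset] at ha
    exact rightMult_nonneg ha
  have hsum0 := Finset.sum_nonneg hnn
  obtain ⟨T, hT, hsum⟩ := exists_prefixOnce_finset hur hw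
  rw [(hR w hw).2] at hsum
  have hTnn : ∀ y ∈ T, 0 ≤ rightMult u y := fun y hy => rightMult_nonneg ((hT y).1 hy).1
  have hwT : w ∈ T := (hT w).2 ⟨hw, prefixOnce_self w⟩
  have hsplit := Finset.add_sum_erase T (rightMult u) hwT
  have hnn' : ∀ y ∈ T.erase w, 0 ≤ rightMult u y :=
    fun y hy => hTnn y (Finset.mem_of_mem_erase hy)
  have hrest := Finset.sum_nonneg hnn'
  push_cast at hsum
  by_cases hs : rightMult u w = 2
  · -- `w` is the only right special factor in its tree.
    have hzero := (Finset.sum_eq_zero_iff_of_nonneg hnn').1 (by linarith)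
    obtain ⟨a, ha, hmax⟩ : ∃ a ∈ leftExt u w,
        ∀ b ∈ leftExt u w, 0 < rightMult u (b :: w) → b = a := by
      by_cases hex : ∃ a ∈ leftExt u w, 0 < rightMult u (a :: w)
      · obtain ⟨a, ha, hpos⟩ := hex
        refine ⟨a, ha, fun b hb hbpos => ?_⟩
        by_contra hne
        have := Finset.add_le_sum hnn (Set.mem_toFinset.2 ha) (Set.mem_toFinset.2 hb) (Ne.symm hne)
        linarith
      · obtain ⟨a, ha⟩ := hur.nonempty_leftExt hw
        exact ⟨a, ha, fun b hb hpos => absurd ⟨b, hb, hpos⟩ hex⟩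
    have hcard := ncard_returnWords_eq hur (v := a :: w) ha fun y hy hay hpos => by
      have hwy : w <:+: y := (List.suffix_cons a w).isInfix.trans hay.1.isInfix
      obtain ⟨z, hz, hzf, hwz, hzpos⟩ := exists_suffix_rightMult_pos hy hwy hpos
      obtain rfl : z = w := by
        by_contra hne
        have := hzero z (Finset.mem_erase.2 ⟨hne, (hT z).2 ⟨hzf, hwz⟩⟩)
        omega
      have hlen := hay.1.length_le
      obtain ⟨b, hb, hby⟩ := exists_cons_suffix hy hz (by simpa using hlen)
      obtain rfl := hmax b hb (hpos.trans_le (rightMult_le_of_suffix hby))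
      exact hay.eq_of_suffix hby
    have hle := Finset.single_le_sum hnn (Set.mem_toFinset.2 ha)
    rw [(hR _ ha).2] at hcard
    push_cast at hcard
    linarith
  · -- `w` and one more factor `v` are the right special factors in the tree of `w`.
    have hs1 : rightMult u w = 1 := by omega
    have hzero := (Finset.sum_eq_zero_iff_of_nonneg hnn).1 (by linarith)
    obtain ⟨v, hv, hvpos⟩ : ∃ v ∈ T.erase w, 0 < rightMult u v :=
      Finset.exists_lt_of_sum_lt (by simp; linarith)
    have hmax : ∀ z ∈ T.erase w, 0 < rightMult u z → z = v := by
      intro z hz hzpos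
      by_contra hne
      have := Finset.add_le_sum hnn' hz hv hne
      linarith
    have hvle := Finset.single_le_sum hnn' hv
    obtain ⟨hvf, hwv⟩ := (hT v).1 (Finset.mem_of_mem_erase hv)
    have hvw : w.length < v.length := by
      refine lt_of_le_of_ne hwv.1.length_le fun h => (Finset.mem_erase.1 hv).1 ?_
      exact (hwv.1.eq_of_length h).symm
    have hcard := ncard_returnWords_eq hur hvf fun y hy hvy hpos => by
      obtain ⟨z, hz, hzf, hwz, hzpos⟩ :=
        exists_suffix_rightMult_pos hy (hwv.1.trans hvy.1).isInfix hpos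
      by_cases hzw : z = w
      · subst hzw
        obtain ⟨b, hb, hby⟩ := exists_cons_suffix hy hz (hvw.trans_le hvy.1.length_le)
        have h1 := hzero b (Set.mem_toFinset.2 hb)
        have h2 := hpos.trans_le (rightMult_le_of_suffix hby)
        omega
      · obtain rfl := hmax z (Finset.mem_erase.2 ⟨hzw, (hT z).2 ⟨hzf, hwz⟩⟩) hzpos
        exact hvy.eq_of_suffix hz
    rw [(hR _ hvf).2] at hcard
    push_cast at hcard
    linarith

theorem complexity_zero : Complexity u 0 = 1 := by
  rw [← card_factors, Finset.card_eq_one]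
  refine ⟨[], ?_⟩
  ext y
  rw [mem_factors, Finset.mem_singleton, List.length_eq_zero_iff]
  refine ⟨fun h => h.1, fun h => ⟨h, 0, ?_⟩⟩
  subst h
  simp [occursAt_iff]

end Finite

end Auxiliary

/-- A uniformly recurrent word `u` satisfies `R_3` if and only if
`C(n) = 2n + 1` for all `n ≥ 0` and `u` has no weak bispecial factor. -/
theorem propertyR_three_iff [Fintype A] (u : ℕ → A) (hur : UniformlyRecurrent u) :
    PropertyR u 3 ↔
      ((∀ n, Complexity u n = 2 * n + 1) ∧ ∀ w, ¬ WeakBispecial u w) := by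
  have hnil : IsFactor u [] := ⟨0, by simp [occursAt_iff]⟩
  have hnonneg : (∀ w, ¬ WeakBispecial u w) → ∀ n, ∀ x ∈ factors u n, 0 ≤ bilateralOrder u x :=
    fun h n x hx => not_lt.1 fun hlt => h x ⟨(mem_factors.1 hx).2, hlt⟩
  constructor
  · intro hR
    have hweak := PropertyR.not_weakBispecial hur hR
    refine ⟨?_, hweak⟩
    have hB := hnonneg hweak
    have hmono : Monotone fun n => ∑ x ∈ factors u n, rightMult u x := by
      refine monotone_nat_of_le_succ fun n => ?_
      have h1 := sum_bilateralOrder_factors (u := u) n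
      have h2 := Finset.sum_nonneg (hB n)
      linarith
    have hupper : ∀ n, ∑ x ∈ factors u n, rightMult u x ≤ 2 := by
      intro n
      have hw : IsFactor u (factorAt u 0 n) := ⟨0, occursAt_factorAt u 0 n⟩
      obtain ⟨m, hm⟩ := exists_sum_rightMult_factors hur hw
      rw [(hR _ hw).2, length_factorAt] at hm
      have hle : ∑ k ∈ Finset.range m,
          ∑ x ∈ factorsContaining u (factorAt u 0 n) k, bilateralOrder u x ≤
          ∑ k ∈ Finset.range m, (∑ x ∈ factors u (n + (k + 1)), rightMult u x -
            ∑ x ∈ factors u (n + k), rightMult u x) := by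
        refine Finset.sum_le_sum fun k _ => ?_
        have hsub := factorsContaining_subset (u := u) (factorAt u 0 n) k
        rw [length_factorAt] at hsub
        rw [← add_assoc, ← sum_bilateralOrder_factors]
        exact Finset.sum_le_sum_of_subset_of_nonneg hsub fun x hx _ => hB _ x hx
      rw [Finset.sum_range_sub (fun k => ∑ x ∈ factors u (n + k), rightMult u x)] at hle
      push_cast at hm
      simp only [add_zero] at hle
      linarith
    have hzero : 2 ≤ ∑ x ∈ factors u 0, rightMult u x := by
      have hcard := ncard_returnWords_eq hur hnil fun y _ hy _ => by
        simpa using hy.2 y []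
      have hle := Finset.single_le_sum (f := rightMult u) (s := factors u 0)
        (fun x hx => rightMult_nonneg (mem_factors.1 hx).2) (mem_factors.2 ⟨rfl, hnil⟩)
      rw [(hR _ hnil).2] at hcard
      push_cast at hcard
      linarith
    intro n
    induction n with
    | zero => simp [complexity_zero]
    | succ n ih =>
      have h1 := hupper n
      have h2 := hmono (Nat.zero_le n)
      have h3 := sum_rightMult_factors (u := u) n
      simp only at h2
      omega
  · rintro ⟨hC, hweak⟩ w hw
    have hB := hnonneg hweak
    refine ⟨finite_returnWords hur hw, ?_⟩
    have hsum : ∀ n, ∑ x ∈ factors u n, rightMult u x = 2 := by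
      intro n
      rw [sum_rightMult_factors, hC, hC]
      push_cast
      ring
    obtain ⟨n, hn⟩ := exists_sum_rightMult_factors hur hw
    have hz : ∑ k ∈ Finset.range n, ∑ x ∈ factorsContaining u w k, bilateralOrder u x = 0 := by
      refine Finset.sum_eq_zero fun k _ => Finset.sum_eq_zero fun x hx => ?_
      have htot := sum_bilateralOrder_factors (u := u) (w.length + k)
      rw [hsum, hsum, sub_self, Finset.sum_eq_zero_iff_of_nonneg (hB _)] at htot
      exact htot x (factorsContaining_subset w k hx)
    rw [hsum, hz] at hn
    omega
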